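/- Let f(x) = Σ_{α∈S} c_α x^α + d x^β be a circuit polynomial on a circuit (S, β), i.e., S ⊆ (2ℕ)^n is affinely independent, β ∈ ℕ^n lies in the relative interior of conv(S), and c_α > 0 for all α ∈ S. Then f is nonnegative on ℝ^n if and only if f is a sum of monomial squares or |d| ≤ Θ_f, where Θ_f is the circuit number of f. -/

import Mathlib

open MvPolynomial Finset

/-- A lattice exponent is even if every entry is even. -/
def IsEvenPt {n : ℕ} (α : Fin n →₀ ℕ) : Prop := ∀ i, Even (α i)

/-- The embedding of a lattice exponent into `ℝⁿ`. -/
def toR {n : ℕ} (α : Fin n →₀ ℕ) : Fin n → ℝ := fun i => (α i : ℝ)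

/-- `(S, β)` is a (simplicial) circuit on the ground set `A`:
`S ⊆ A ∩ (2ℕ)ⁿ` is affinely independent and `β ∈ A` lies in the relative
interior of `conv S`. -/
structure IsCircuitOn {n : ℕ} (A : Finset (Fin n →₀ ℕ)) (S : Finset (Fin n →₀ ℕ))
    (β : Fin n →₀ ℕ) : Prop where
  subset : S ⊆ A
  even_mem : ∀ α ∈ S, IsEvenPt α
  beta_mem : β ∈ A
  indep : AffineIndependent ℝ (fun α : S => toR (α : Fin n →₀ ℕ))
  relint : toR β ∈ intrinsicInterior ℝ (convexHull ℝ (toR '' (S : Set (Fin n →₀ ℕ))))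

/-- `lam` gives the barycentric coordinates of `β` with respect to `S`. -/
def IsBarycentric {n : ℕ} (S : Finset (Fin n →₀ ℕ)) (β : Fin n →₀ ℕ)
    (lam : (Fin n →₀ ℕ) → ℝ) : Prop :=
  (∀ α ∈ S, 0 < lam α) ∧ ∑ α ∈ S, lam α = 1 ∧
    ∀ i, (β i : ℝ) = ∑ α ∈ S, lam α * (α i : ℝ)

/-- The circuit number `Θ = ∏_{α ∈ S} (c_α / λ_α) ^ (λ_α)`. -/
noncomputable def circuitNumber {n : ℕ} (S : Finset (Fin n →₀ ℕ))
    (c lam : (Fin n →₀ ℕ) → ℝ) : ℝ :=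
  ∏ α ∈ S, (c α / lam α) ^ (lam α)

/-- The circuit polynomial `∑_{α ∈ S} c_α x^α + d x^β`. -/
noncomputable def circuitPoly {n : ℕ} (S : Finset (Fin n →₀ ℕ)) (β : Fin n →₀ ℕ)
    (c : (Fin n →₀ ℕ) → ℝ) (d : ℝ) : MvPolynomial (Fin n) ℝ :=
  (∑ α ∈ S, monomial α (c α)) + monomial β d

/-- Generators of the SONC cone on `A`: nonnegative circuit polynomials on circuits
on `A`, together with monomial squares `x^α`, `α ∈ A ∩ (2ℕ)ⁿ`. -/
def SONCGen {n : ℕ} (A : Finset (Fin n →₀ ℕ)) : Set (MvPolynomial (Fin n) ℝ) :=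
  {f | (∃ S β c d, IsCircuitOn A S β ∧ (∀ α ∈ S, 0 < c α) ∧
          f = circuitPoly S β c d ∧ ∀ x : Fin n → ℝ, 0 ≤ eval x f) ∨
       (∃ α ∈ A, IsEvenPt α ∧ f = monomial α 1)}

/-- The SONC cone on `A`: all finite nonnegative combinations of the generators. -/
def SONCCone {n : ℕ} (A : Finset (Fin n →₀ ℕ)) : Set (MvPolynomial (Fin n) ℝ) :=
  {f | ∃ (k : ℕ) (g : Fin k → MvPolynomial (Fin n) ℝ) (μ : Fin k → ℝ),
        (∀ i, g i ∈ SONCGen A ∧ 0 ≤ μ i) ∧ f = ∑ i, μ i • g i}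

/-- The ray `ℝ₊ · f`. -/
def raySet {n : ℕ} (f : MvPolynomial (Fin n) ℝ) : Set (MvPolynomial (Fin n) ℝ) :=
  {p | ∃ t : ℝ, 0 ≤ t ∧ p = t • f}

/-- `ℝ₊ · f` is an extreme ray of the convex cone `K`. -/
def IsExtremeRay {n : ℕ} (K : Set (MvPolynomial (Fin n) ℝ))
    (f : MvPolynomial (Fin n) ℝ) : Prop :=
  f ≠ 0 ∧ f ∈ K ∧ ∀ g h, g ∈ K → h ∈ K → f = g + h → g ∈ raySet f ∧ h ∈ raySet f

/-- The ray `ℝ₊ · f` is an exposed face of `K`: some linear functional vanishes on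
the ray and is strictly positive on the rest of `K`. -/
def IsExposedRay {n : ℕ} (K : Set (MvPolynomial (Fin n) ℝ))
    (f : MvPolynomial (Fin n) ℝ) : Prop :=
  ∃ l : MvPolynomial (Fin n) ℝ →ₗ[ℝ] ℝ,
    (∀ p ∈ raySet f, l p = 0) ∧ ∀ g ∈ K \ raySet f, 0 < l g

/-- `(S, β)` is a reduced circuit on `A`: the only even points of `A` in `conv S`
are those of `S ∪ {β}`. -/
def IsReducedCircuitOn {n : ℕ} (A : Finset (Fin n →₀ ℕ)) (S : Finset (Fin n →₀ ℕ))
    (β : Fin n →₀ ℕ) : Prop :=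
  IsCircuitOn A S β ∧
    {γ : Fin n →₀ ℕ | γ ∈ A ∧ IsEvenPt γ ∧
        toR γ ∈ convexHull ℝ (toR '' (S : Set (Fin n →₀ ℕ)))} =
      {γ : Fin n →₀ ℕ | (γ ∈ S ∨ γ = β) ∧ IsEvenPt γ}

/-- `(S, β)` is a (simplicial) circuit (no ground set): `S ⊆ (2ℕ)ⁿ` is affinely
independent and `β ∈ ℕⁿ` lies in the relative interior of `conv S`. -/
structure IsCircuitPair {n : ℕ} (S : Finset (Fin n →₀ ℕ)) (β : Fin n →₀ ℕ) : Prop where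
  even_mem : ∀ α ∈ S, IsEvenPt α
  indep : AffineIndependent ℝ (fun α : S => toR (α : Fin n →₀ ℕ))
  relint : toR β ∈ intrinsicInterior ℝ (convexHull ℝ (toR '' (S : Set (Fin n →₀ ℕ))))

/-- `f` is a sum of monomial squares: a nonnegative combination of monomials `x^γ`
with `γ` even. -/
def IsSumMonSquares {n : ℕ} (f : MvPolynomial (Fin n) ℝ) : Prop :=
  ∃ (T : Finset (Fin n →₀ ℕ)) (e : (Fin n →₀ ℕ) → ℝ),
    (∀ γ ∈ T, 0 ≤ e γ ∧ IsEvenPt γ) ∧ f = ∑ γ ∈ T, monomial γ (e γ)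

/-- An affinely independent finite family of points of `ℝⁿ` can be assigned arbitrary values by
an affine function. -/
theorem AffineIndependent.exists_affine_interpolation {ι κ : Type*} [Fintype κ]
    {p : ι → κ → ℝ} (hp : AffineIndependent ℝ p) (w : ι → ℝ) :
    ∃ (v : κ → ℝ) (t : ℝ), ∀ j, ∑ i, p j i * v i = w j + t := by
  classical
  have hli : LinearIndependent ℝ (fun j => ((p j, 1) : (κ → ℝ) × ℝ)) := by
    rw [linearIndependent_iff']
    intro s g hg
    rw [affineIndependent_iff] at hp
    refine hp s g ?_ ?_
    · simpa [Prod.snd_sum] using congrArg Prod.snd hg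
    · simpa [Prod.fst_sum] using congrArg Prod.fst hg
  obtain ⟨g, hg⟩ := LinearMap.exists_leftInverse_of_injective _ (LinearMap.ker_eq_bot.mpr hli)
  let φ : (κ → ℝ) × ℝ →ₗ[ℝ] ℝ := Finsupp.linearCombination ℝ w ∘ₗ g
  have hφ (j : ι) : φ (p j, 1) = w j := by
    simpa [φ] using
      congrArg (Finsupp.linearCombination ℝ w) (LinearMap.congr_fun hg (Finsupp.single j 1))
  refine ⟨fun i => φ (Pi.single i 1, 0), -φ (0, 1), fun j => ?_⟩
  have hdecomp : (p j, (1 : ℝ)) = ∑ i, p j i • ((Pi.single i 1, 0) : (κ → ℝ) × ℝ) + (0, 1) := by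
    ext k
    · simp [Prod.fst_sum, Finset.sum_apply, Pi.single_apply]
    · simp [Prod.snd_sum]
  have := hφ j
  rw [hdecomp, map_add, map_sum] at this
  simp only [map_smul, smul_eq_mul] at this
  linarith

section CircuitPolynomials

variable {n : ℕ} {S : Finset (Fin n →₀ ℕ)} {α β : Fin n →₀ ℕ} {c lam : (Fin n →₀ ℕ) → ℝ} {d : ℝ}

theorem eval_circuitPoly (x : Fin n → ℝ) :
    eval x (circuitPoly S β c d) =
      ∑ α ∈ S, c α * ∏ i, x i ^ α i + d * ∏ i, x i ^ β i := by
  simp [circuitPoly, eval_monomial, Finsupp.prod_fintype]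

theorem IsEvenPt.prod_abs_pow (hα : IsEvenPt α) (x : Fin n → ℝ) :
    ∏ i, |x i| ^ α i = ∏ i, x i ^ α i :=
  Finset.prod_congr rfl fun i _ => (hα i).pow_abs (x i)

theorem IsEvenPt.prod_pow_nonneg (hα : IsEvenPt α) (x : Fin n → ℝ) : 0 ≤ ∏ i, x i ^ α i :=
  Finset.prod_nonneg fun i _ => (hα i).pow_nonneg (x i)

theorem IsSumMonSquares.eval_nonneg {f : MvPolynomial (Fin n) ℝ} (hf : IsSumMonSquares f)
    (x : Fin n → ℝ) : 0 ≤ eval x f := by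
  obtain ⟨T, e, hT, rfl⟩ := hf
  rw [map_sum]
  refine Finset.sum_nonneg fun γ hγ => ?_
  rw [eval_monomial, Finsupp.prod_fintype _ _ (by simp)]
  exact mul_nonneg (hT γ hγ).1 ((hT γ hγ).2.prod_pow_nonneg x)

theorem isSumMonSquares_circuitPoly (hS : ∀ α ∈ S, IsEvenPt α) (hc : ∀ α ∈ S, 0 < c α)
    (hβ : IsEvenPt β) (hd : 0 ≤ d) : IsSumMonSquares (circuitPoly S β c d) := by
  classical
  have hcoeff (γ : Fin n →₀ ℕ) : coeff γ (circuitPoly S β c d) =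
      (if γ ∈ S then c γ else 0) + if β = γ then d else 0 := by
    simp [circuitPoly, coeff_sum, coeff_monomial]
  refine ⟨(circuitPoly S β c d).support, fun γ => coeff γ (circuitPoly S β c d), fun γ hγ => ?_,
    (support_sum_monomial_coeff _).symm⟩
  rw [mem_support_iff, hcoeff] at hγ
  beta_reduce
  rw [hcoeff]
  constructor
  · refine add_nonneg ?_ ?_ <;> split_ifs with h
    exacts [(hc γ h).le, le_rfl, hd, le_rfl]
  · by_cases h : γ ∈ S
    · exact hS γ h
    · by_cases h' : β = γ
      · exact h' ▸ hβ
      · simp [h, h'] at hγ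

/-- The monomial at the barycentre is the weighted geometric mean of the vertex monomials. -/
theorem IsBarycentric.prod_rpow_prod_pow (hlam : IsBarycentric S β lam) {y : Fin n → ℝ}
    (hy : ∀ i, 0 ≤ y i) :
    ∏ α ∈ S, (∏ i, y i ^ α i) ^ lam α = ∏ i, y i ^ β i := by
  have hα (α : Fin n →₀ ℕ) :
      (∏ i, y i ^ α i) ^ lam α = ∏ i, y i ^ (lam α * (α i : ℝ)) := by
    rw [← Real.finsetProd_rpow _ _ fun i _ => pow_nonneg (hy i) _]
    refine Finset.prod_congr rfl fun i _ => ?_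
    rw [mul_comm, Real.rpow_mul (hy i), Real.rpow_natCast]
  simp_rw [hα]
  rw [Finset.prod_comm]
  refine Finset.prod_congr rfl fun i _ => ?_
  rw [← Real.rpow_natCast, hlam.2.2 i, Real.rpow_sum_of_nonneg (hy i)]
  exact fun α hα => mul_nonneg (hlam.1 α hα).le (Nat.cast_nonneg _)

theorem IsBarycentric.circuitNumber_mul_le (hlam : IsBarycentric S β lam)
    (hc : ∀ α ∈ S, 0 < c α) {y : Fin n → ℝ} (hy : ∀ i, 0 ≤ y i) :
    circuitNumber S c lam * ∏ i, y i ^ β i ≤ ∑ α ∈ S, c α * ∏ i, y i ^ α i := by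
  have hq (α) (hα : α ∈ S) : 0 ≤ c α / lam α := (div_pos (hc α hα) (hlam.1 α hα)).le
  have hm (α : Fin n →₀ ℕ) : 0 ≤ ∏ i, y i ^ α i :=
    Finset.prod_nonneg fun i _ => pow_nonneg (hy i) _
  have hamgm := Real.geom_mean_le_arith_mean_weighted S lam
    (fun α => c α / lam α * ∏ i, y i ^ α i) (fun α hα => (hlam.1 α hα).le) hlam.2.1
    (fun α hα => mul_nonneg (hq α hα) (hm α))
  rw [Finset.prod_congr rfl fun α hα => Real.mul_rpow (hq α hα) (hm α), Finset.prod_mul_distrib,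
    hlam.prod_rpow_prod_pow hy] at hamgm
  refine hamgm.trans_eq (Finset.sum_congr rfl fun α hα => ?_)
  have := (hlam.1 α hα).ne'
  field_simp

theorem eval_circuitPoly_nonneg (hS : ∀ α ∈ S, IsEvenPt α) (hlam : IsBarycentric S β lam)
    (hc : ∀ α ∈ S, 0 < c α) (hd : |d| ≤ circuitNumber S c lam) (x : Fin n → ℝ) :
    0 ≤ eval x (circuitPoly S β c d) := by
  have h := hlam.circuitNumber_mul_le hc (y := fun i => |x i|) fun i => abs_nonneg _
  rw [Finset.sum_congr rfl fun α hα => by rw [(hS α hα).prod_abs_pow x]] at h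
  have hβ : |d * ∏ i, x i ^ β i| ≤ circuitNumber S c lam * ∏ i, |x i| ^ β i := by
    rw [abs_mul, Finset.abs_prod]
    simp_rw [abs_pow]
    exact mul_le_mul_of_nonneg_right hd (Finset.prod_nonneg fun i _ => by positivity)
  rw [eval_circuitPoly]
  linarith [neg_abs_le (d * ∏ i, x i ^ β i)]

/-- There is a positive point at which the weighted AM-GM inequality for the vertex monomials
is an equality. -/
theorem exists_pos_circuitNumber_mul_eq
    (hindep : AffineIndependent ℝ (fun α : S => toR (α : Fin n →₀ ℕ)))
    (hlam : IsBarycentric S β lam) (hc : ∀ α ∈ S, 0 < c α) :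
    ∃ y : Fin n → ℝ, (∀ i, 0 < y i) ∧
      ∑ α ∈ S, c α * ∏ i, y i ^ α i = circuitNumber S c lam * ∏ i, y i ^ β i := by
  obtain ⟨v, t, hvt⟩ := hindep.exists_affine_interpolation
    (fun α : S => Real.log (lam α / c α))
  have hy (i : Fin n) : 0 < Real.exp (v i) := Real.exp_pos _
  refine ⟨fun i => Real.exp (v i), hy, ?_⟩
  have hvert (α) (hα : α ∈ S) : ∏ i, Real.exp (v i) ^ α i = lam α / c α * Real.exp t := by
    simp_rw [← Real.exp_nat_mul, ← Real.exp_sum]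
    have h := hvt ⟨α, hα⟩
    simp only [toR] at h
    rw [h, Real.exp_add, Real.exp_log (div_pos (hlam.1 α hα) (hc α hα))]
  have hsum : ∑ α ∈ S, c α * ∏ i, Real.exp (v i) ^ α i = Real.exp t := by
    rw [← one_mul (Real.exp t), ← hlam.2.1, Finset.sum_mul]
    refine Finset.sum_congr rfl fun α hα => ?_
    rw [hvert α hα]
    have := (hc α hα).ne'
    field_simp
  rw [hsum, ← hlam.prod_rpow_prod_pow fun i => (hy i).le, circuitNumber,
    ← Finset.prod_mul_distrib]
  rw [← Real.rpow_one (Real.exp t), ← hlam.2.1, Real.rpow_sum_of_pos (Real.exp_pos t)]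
  refine Finset.prod_congr rfl fun α hα => ?_
  have hl := hlam.1 α hα
  have hcα := hc α hα
  rw [hvert α hα, ← Real.mul_rpow (by positivity) (by positivity)]
  congr 1
  field_simp

/-- If `d > 0` and `β` is not even, flipping one sign makes the inner term negative. -/
theorem exists_abs_eq_and_mul_prod_pow_eq_neg (h : d ≤ 0 ∨ ¬ IsEvenPt β) {y : Fin n → ℝ}
    (hy : ∀ i, 0 < y i) :
    ∃ x : Fin n → ℝ, (∀ i, |x i| = y i) ∧ d * ∏ i, x i ^ β i = -(|d| * ∏ i, y i ^ β i) := by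
  classical
  rcases le_or_gt d 0 with hd | hd
  · exact ⟨y, fun i => abs_of_pos (hy i), by rw [abs_of_nonpos hd]; ring⟩
  · obtain ⟨k, hk⟩ := not_forall.mp (h.resolve_left hd.not_ge)
    refine ⟨Function.update y k (-y k), fun i => ?_, ?_⟩
    · rcases eq_or_ne i k with rfl | hik
      · simp [abs_of_pos (hy i)]
      · simp [hik, abs_of_pos (hy i)]
    · rw [abs_of_pos hd, ← Finset.mul_prod_erase _ _ (Finset.mem_univ k),
        ← Finset.mul_prod_erase univ (fun i => y i ^ β i) (Finset.mem_univ k),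
        Function.update_self, (Nat.not_even_iff_odd.mp hk).neg_pow,
        Finset.prod_congr rfl fun i hi => by
          rw [Function.update_of_ne (Finset.ne_of_mem_erase hi)]]
      ring

theorem abs_le_circuitNumber (hcirc : IsCircuitPair S β) (hlam : IsBarycentric S β lam)
    (hc : ∀ α ∈ S, 0 < c α) (hf : ∀ x : Fin n → ℝ, 0 ≤ eval x (circuitPoly S β c d))
    (h : d ≤ 0 ∨ ¬ IsEvenPt β) : |d| ≤ circuitNumber S c lam := by
  obtain ⟨y, hy, hyeq⟩ := exists_pos_circuitNumber_mul_eq hcirc.indep hlam hc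
  obtain ⟨x, hxy, hx⟩ := exists_abs_eq_and_mul_prod_pow_eq_neg h hy
  have hfx := hf x
  rw [eval_circuitPoly, hx, Finset.sum_congr rfl fun α hα => by
    rw [← (hcirc.even_mem α hα).prod_abs_pow x]] at hfx
  simp_rw [hxy] at hfx
  rw [hyeq] at hfx
  exact le_of_mul_le_mul_right (by linarith) (Finset.prod_pos fun i _ => pow_pos (hy i) (β i))

end CircuitPolynomials

/-- **Nonnegativity criterion for circuit polynomials** (Iliman–de Wolff):
a circuit polynomial `f = ∑ c_α x^α + d x^β` is nonnegative on `ℝⁿ` if and only if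
it is a sum of monomial squares or `|d| ≤ Θ_f`. -/
theorem circuitPoly_nonneg_iff {n : ℕ} (S : Finset (Fin n →₀ ℕ)) (β : Fin n →₀ ℕ)
    (c lam : (Fin n →₀ ℕ) → ℝ) (d : ℝ) (hcirc : IsCircuitPair S β)
    (hlam : IsBarycentric S β lam) (hc : ∀ α ∈ S, 0 < c α) :
    (∀ x : Fin n → ℝ, 0 ≤ eval x (circuitPoly S β c d)) ↔
      (IsSumMonSquares (circuitPoly S β c d) ∨ |d| ≤ circuitNumber S c lam) := by
  constructor
  · intro hf
    by_cases h : d ≤ 0 ∨ ¬ IsEvenPt β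
    · exact Or.inr (abs_le_circuitNumber hcirc hlam hc hf h)
    · push Not at h
      exact Or.inl (isSumMonSquares_circuitPoly hcirc.even_mem hc h.2 h.1.le)
  · rintro (h | h)
    exacts [h.eval_nonneg, eval_circuitPoly_nonneg hcirc.even_mem hlam hc h]
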